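/- Let $M^n$, $n \geq 3$, be an $n$-dimensional minimal submanifold (i.e., one with vanishing mean curvature vector $H = 0$) of an $m$-dimensional, $m \geq 4$, conformally flat Riemannian manifold $(\widetilde{M}^m, \widetilde{g})$. Then $\rho + \rho^{\perp} \leq \frac{2}{n(m-2)} \sum_{j=1}^n \widetilde{Ric}(e_j, e_j) - \frac{2\widetilde{\tau}}{(m-1)(m-2)}$, where $\{e_j\}_{1 \leq j \leq n}$ is a local orthonormal frame of the tangent bundle of $M^n$. -/

import Mathlib

open Finset Matrix

/-- Kronecker delta (the components of the metric in an orthonormal frame). -/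
noncomputable def kdelta {k : ℕ} (a b : Fin k) : ℝ := if a = b then 1 else 0

/-- The scalar curvature `tau = sum_{i<j} R(e_i, e_j, e_j, e_i)` computed from the
components of the curvature tensor in an orthonormal frame. -/
noncomputable def scalarCurv {n : ℕ} (R : Fin n → Fin n → Fin n → Fin n → ℝ) : ℝ :=
  ∑ i : Fin n, ∑ j : Fin n, if i < j then R i j j i else 0

/-- The normalized scalar curvature `rho = 2 tau / (n (n - 1))`. -/
noncomputable def normScalarCurv {n : ℕ} (R : Fin n → Fin n → Fin n → Fin n → ℝ) : ℝ :=
  2 * scalarCurv R / ((n : ℝ) * ((n : ℝ) - 1))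

/-- The normal scalar curvature `K_N = -(1/4) sum_{r,s} trace ([A_r, A_s]^2)` computed from
the shape operators (given as symmetric matrices in an orthonormal tangent frame). -/
noncomputable def KN {n p : ℕ} (A : Fin p → Matrix (Fin n) (Fin n) ℝ) : ℝ :=
  -(1 / 4) * ∑ r : Fin p, ∑ s : Fin p,
    Matrix.trace ((A r * A s - A s * A r) * (A r * A s - A s * A r))

/-- The normalized normal scalar curvature `rho_N = (2/(n(n-1))) sqrt(K_N)`. -/
noncomputable def rhoN {n p : ℕ} (A : Fin p → Matrix (Fin n) (Fin n) ℝ) : ℝ :=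
  2 / ((n : ℝ) * ((n : ℝ) - 1)) * Real.sqrt (KN A)

/-- The squared mean curvature `|H|^2 = sum_r ((1/n) trace A_r)^2` computed from the
components of the second fundamental form in adapted orthonormal frames. -/
noncomputable def meanCurvSq {n p : ℕ} (A : Fin p → Matrix (Fin n) (Fin n) ℝ) : ℝ :=
  ∑ r : Fin p, ((1 / (n : ℝ)) * ∑ i : Fin n, A r i i) ^ 2

/-- The normalized normal scalar curvature
`rho^perp = (2/(n(n-1))) sqrt( sum_{i<j} sum_{r<s} (Rperp(e_i,e_j,v_r,v_s))^2 )`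
computed from the components of the normal curvature tensor. -/
noncomputable def rhoPerp {n p : ℕ} (Rp : Fin n → Fin n → Fin p → Fin p → ℝ) : ℝ :=
  2 / ((n : ℝ) * ((n : ℝ) - 1)) *
    Real.sqrt (∑ i : Fin n, ∑ j : Fin n, ∑ r : Fin p, ∑ s : Fin p,
      if i < j ∧ r < s then Rp i j r s ^ 2 else 0)

/-- The Ricci curvature `Ric(e_b, e_c) = sum_a R(e_a, e_b, e_c, e_a)` computed from the
components of the curvature tensor in an orthonormal frame. -/
noncomputable def ambRicci {m : ℕ} (Rt : Fin m → Fin m → Fin m → Fin m → ℝ)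
    (b c : Fin m) : ℝ :=
  ∑ a : Fin m, Rt a b c a

/-- The (ambient) scalar curvature `tau = sum_{a<b} sigma(e_a, e_b) = (1/2) sum_a Ric(e_a,e_a)`. -/
noncomputable def ambScalar {m : ℕ} (Rt : Fin m → Fin m → Fin m → Fin m → ℝ) : ℝ :=
  (1 / 2) * ∑ a : Fin m, ambRicci Rt a a

section DDVV

variable {ι κ : Type*} [Fintype ι]

/-- The Frobenius inner product of two real square matrices. -/
def frob (M N : Matrix ι ι ℝ) : ℝ := ∑ i, ∑ j, M i j * N i j

lemma frob_eq_trace (M N : Matrix ι ι ℝ) : frob M N = trace (M * Nᵀ) := by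
  simp [frob, trace, mul_apply]

lemma frob_sum_smul (T : Finset κ) (a b : κ → ℝ) (M : κ → Matrix ι ι ℝ) :
    frob (∑ s ∈ T, a s • M s) (∑ t ∈ T, b t • M t)
      = ∑ s ∈ T, ∑ t ∈ T, a s * b t * frob (M s) (M t) := by
  simp only [frob_eq_trace, transpose_sum, Finset.sum_mul_sum, trace_sum,
    transpose_smul, Matrix.smul_mul, Matrix.mul_smul, trace_smul, smul_eq_mul]
  exact Finset.sum_congr rfl fun s _ => Finset.sum_congr rfl fun t _ => by ring

lemma frob_conj [DecidableEq ι] {U : Matrix ι ι ℝ} (hU : U * Uᵀ = 1) (M N : Matrix ι ι ℝ) :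
    frob (Uᵀ * M * U) (Uᵀ * N * U) = frob M N := by
  rw [frob_eq_trace, frob_eq_trace]
  have h1 : Uᵀ * M * U * (Uᵀ * N * U)ᵀ = Uᵀ * (M * (U * Uᵀ) * Nᵀ * U) := by
    simp only [transpose_mul, transpose_transpose, Matrix.mul_assoc]
  rw [h1, trace_mul_comm, hU, Matrix.mul_one, Matrix.mul_assoc, hU, Matrix.mul_one]

lemma exists_orthogonal_diagonalization [DecidableEq ι] {A : Matrix ι ι ℝ} (hA : A.IsSymm) :
    ∃ (U : Matrix ι ι ℝ) (η : ι → ℝ), U * Uᵀ = 1 ∧ Uᵀ * A * U = diagonal η := by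
  have hH : A.IsHermitian := by
    rw [Matrix.IsHermitian, conjTranspose_eq_transpose_of_trivial]; exact hA
  have h1 : (hH.eigenvectorUnitary : Matrix ι ι ℝ) *
      (hH.eigenvectorUnitary : Matrix ι ι ℝ)ᵀ = 1 := by
    have := (Matrix.mem_unitaryGroup_iff).1 hH.eigenvectorUnitary.2
    rwa [star_eq_conjTranspose, conjTranspose_eq_transpose_of_trivial] at this
  have h2 := mul_eq_one_comm.1 h1
  refine ⟨(hH.eigenvectorUnitary : Matrix ι ι ℝ), hH.eigenvalues, h1, ?_⟩
  have h3 := hH.spectral_theorem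
  rw [Unitary.conjStarAlgAut_apply, star_eq_conjTranspose,
    conjTranspose_eq_transpose_of_trivial] at h3
  set U : Matrix ι ι ℝ := hH.eigenvectorUnitary.1
  have h4 : Uᵀ * A * U = (Uᵀ * U) * diagonal (RCLike.ofReal ∘ hH.eigenvalues) * (Uᵀ * U) := by
    conv_lhs => rw [h3]
    simp only [Matrix.mul_assoc]
  rw [h4, h2, Matrix.one_mul, Matrix.mul_one]
  rfl

lemma mul_neg_of_one_lt_sub_sq [DecidableEq ι] {η : ι → ℝ} (hη : ∑ i, η i ^ 2 ≤ 1) {i j : ι}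
    (h : 1 < (η i - η j) ^ 2) : η i * η j < 0 := by
  have hij : i ≠ j := by rintro rfl; norm_num at h
  have := Finset.sum_le_univ_sum_of_nonneg (s := {i, j}) (fun k => sq_nonneg (η k))
  rw [Finset.sum_pair hij] at this
  nlinarith

/-- Index pairs at squared distance greater than `1` form a star. -/
lemma exists_center [DecidableEq ι] {η : ι → ℝ} (hη : ∑ i, η i ^ 2 ≤ 1) [Nonempty ι] :
    ∃ c, ∀ i j, 1 < (η i - η j) ^ 2 → i = c ∨ j = c := by
  have hsymm : ∀ {i j}, 1 < (η i - η j) ^ 2 → 1 < (η j - η i) ^ 2 := by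
    intro i j h; nlinarith
  have meet : ∀ i j k l, 1 < (η i - η j) ^ 2 → 1 < (η k - η l) ^ 2 →
      i = k ∨ i = l ∨ j = k ∨ j = l := by
    intro i j k l h1 h2
    by_contra! hne
    obtain ⟨hik, hil, hjk, hjl⟩ := hne
    have hij : i ≠ j := by rintro rfl; norm_num at h1
    have hkl : k ≠ l := by rintro rfl; norm_num at h2
    have := Finset.sum_le_univ_sum_of_nonneg (s := {i, j, k, l}) (fun k => sq_nonneg (η k))
    rw [Finset.sum_insert (by simp [*]), Finset.sum_insert (by simp [*]),
      Finset.sum_pair hkl] at this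
    nlinarith [sq_nonneg (η i + η j), sq_nonneg (η k + η l)]
  have triangle : ∀ i j k, 1 < (η i - η j) ^ 2 → 1 < (η j - η k) ^ 2 →
      ¬ 1 < (η i - η k) ^ 2 := by
    intro i j k h1 h2 h3
    have h1 := mul_neg_of_one_lt_sub_sq hη h1
    have h2 := mul_neg_of_one_lt_sub_sq hη h2
    have h3 := mul_neg_of_one_lt_sub_sq hη h3
    nlinarith [mul_pos_of_neg_of_neg h1 h2, sq_nonneg (η j),
      mul_nonneg (sq_nonneg (η j)) (neg_nonneg.2 h3.le)]
  by_contra! hcon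
  obtain ⟨a, b, hab, -, -⟩ := hcon (Classical.arbitrary ι)
  obtain ⟨i, j, hij, hia, hja⟩ := hcon a
  obtain ⟨k, l, hkl, hkb, hlb⟩ := hcon b
  have m1 := meet _ _ _ _ hab hij
  have m2 := meet _ _ _ _ hab hkl
  have m3 := meet _ _ _ _ hij hkl
  have t := triangle
  grind

lemma sum_center_le [DecidableEq ι] {η : ι → ℝ} (hη : ∑ i, η i ^ 2 ≤ 1) (c : ι) :
    ∑ j, max ((η c - η j) ^ 2 - 1) 0 ≤ 1 := by
  set L : Finset ι := univ.filter fun j => 1 < (η c - η j) ^ 2 with hL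
  have hc : c ∉ L := by simp [hL]
  have h1 : ∑ j, max ((η c - η j) ^ 2 - 1) 0 = ∑ j ∈ L, ((η c - η j) ^ 2 - 1) := by
    rw [hL, Finset.sum_filter]
    refine Finset.sum_congr rfl fun j _ => ?_
    split_ifs with h
    · exact max_eq_left (by linarith)
    · exact max_eq_right (by linarith)
  have h2 : ∑ j ∈ L, ((η c - η j) ^ 2 - 1)
      = #L * η c ^ 2 - 2 * η c * ∑ j ∈ L, η j + ∑ j ∈ L, η j ^ 2 - #L := by
    simp only [sub_sq, Finset.sum_sub_distrib, Finset.sum_add_distrib, Finset.mul_sum]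
    simp
  have h3 := Finset.sum_le_univ_sum_of_nonneg (s := insert c L) (fun k => sq_nonneg (η k))
  rw [Finset.sum_insert hc] at h3
  have h4 := sq_sum_le_card_mul_sum_sq (s := L) (f := η)
  have h5 : (0 : ℝ) ≤ #L := Nat.cast_nonneg _
  rw [h1, h2]
  nlinarith [sq_nonneg (η c + ∑ j ∈ L, η j),
    mul_nonneg h5 (sub_nonneg.2 (h3.trans hη))]

lemma sum_max_sub_sq_le [DecidableEq ι] {η : ι → ℝ} (hη : ∑ i, η i ^ 2 ≤ 1) :
    ∑ i, ∑ j, max ((η i - η j) ^ 2 - 1) 0 ≤ 2 := by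
  rcases isEmpty_or_nonempty ι with _ | _
  · simp
  obtain ⟨c, hc⟩ := exists_center hη
  set d : ι → ι → ℝ := fun i j => max ((η i - η j) ^ 2 - 1) 0 with hd
  have hd0 : ∀ i j, 0 ≤ d i j := fun i j => le_max_right _ _
  have h1 : ∀ i j, d i j ≤ (if i = c then d c j else 0) + (if j = c then d c i else 0) := by
    intro i j
    by_cases h : 1 < (η i - η j) ^ 2
    · rcases hc i j h with rfl | rfl
      · rw [if_pos rfl]
        have := hd0 i i
        split_ifs <;> linarith
      · rw [if_pos rfl]
        have : d i j = d j i := by simp only [hd]; congr 2; ring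
        have := hd0 j j
        split_ifs <;> linarith [hd0 j j]
    · have : d i j = 0 := max_eq_right (by linarith)
      rw [this]
      have := hd0 c i
      have := hd0 c j
      split_ifs <;> linarith
  calc ∑ i, ∑ j, d i j
      ≤ ∑ i, ∑ j, ((if i = c then d c j else 0) + (if j = c then d c i else 0)) :=
        Finset.sum_le_sum fun i _ => Finset.sum_le_sum fun j _ => h1 i j
    _ = ∑ j, d c j + ∑ i, d c i := by
        simp only [Finset.sum_add_distrib]
        congr 1
        · rw [Finset.sum_comm]; simp
        · simp
    _ ≤ 2 := by linarith [sum_center_le hη c]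

/-- Bessel's inequality for an off-diagonal entry of an orthonormal family of symmetric matrices. -/
lemma sum_entry_sq_le_half [DecidableEq ι] [DecidableEq κ] {T : Finset κ}
    {B : κ → Matrix ι ι ℝ} (hB : ∀ s, (B s).IsSymm)
    (hon : ∀ s ∈ T, ∀ t ∈ T, frob (B s) (B t) = if s = t then 1 else 0) {i j : ι} (hij : i ≠ j) :
    ∑ s ∈ T, B s i j ^ 2 ≤ 1 / 2 := by
  set W : Matrix ι ι ℝ := ∑ s ∈ T, B s i j • B s with hW
  set β := ∑ s ∈ T, B s i j ^ 2 with hβ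
  have hWij : W i j = β := by simp [hW, hβ, Matrix.sum_apply, sq]
  have hWji : W j i = β := by
    simp only [hW, hβ, Matrix.sum_apply, sq, Matrix.smul_apply, smul_eq_mul]
    exact Finset.sum_congr rfl fun s _ => by rw [(hB s).apply]
  have hWW : frob W W = β := by
    rw [hW, frob_sum_smul, hβ]
    refine Finset.sum_congr rfl fun s hs => ?_
    rw [Finset.sum_congr rfl fun t ht => by rw [hon s hs t ht]]
    simp [hs, sq]
  have h2 : W i j ^ 2 + W j i ^ 2 ≤ frob W W := by
    have : frob W W = ∑ p : ι × ι, W p.1 p.2 ^ 2 := by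
      rw [Fintype.sum_prod_type]; simp [frob, sq]
    rw [this]
    have := Finset.sum_le_univ_sum_of_nonneg (s := {(i, j), (j, i)})
      (fun p : ι × ι => sq_nonneg (W p.1 p.2))
    rwa [Finset.sum_pair (by simp [hij])] at this
  rw [hWij, hWji, hWW] at h2
  by_contra! h
  nlinarith

lemma sum_diagonal_commutator_le [DecidableEq ι] [DecidableEq κ] {T : Finset κ}
    {B : κ → Matrix ι ι ℝ} (hB : ∀ s, (B s).IsSymm)
    (hon : ∀ s ∈ T, ∀ t ∈ T, frob (B s) (B t) = if s = t then 1 else 0)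
    {η : ι → ℝ} (hη : ∑ i, η i ^ 2 ≤ 1) :
    ∑ s ∈ T, ∑ i, ∑ j, (η i - η j) ^ 2 * B s i j ^ 2 ≤ #T + 1 := by
  set d : ι → ι → ℝ := fun i j => max ((η i - η j) ^ 2 - 1) 0 with hd
  have hd0 : ∀ i j, 0 ≤ d i j := fun i j => le_max_right _ _
  calc ∑ s ∈ T, ∑ i, ∑ j, (η i - η j) ^ 2 * B s i j ^ 2
      ≤ ∑ s ∈ T, ∑ i, ∑ j, (B s i j * B s i j + d i j * B s i j ^ 2) := by
        gcongr with s _ i _ j _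
        nlinarith [sq_nonneg (B s i j), le_max_left ((η i - η j) ^ 2 - 1) 0]
    _ = ∑ s ∈ T, frob (B s) (B s) + ∑ i, ∑ j, d i j * ∑ s ∈ T, B s i j ^ 2 := by
        simp only [Finset.sum_add_distrib, frob, Finset.mul_sum]
        congr 1
        rw [Finset.sum_comm]
        exact Finset.sum_congr rfl fun i _ => Finset.sum_comm
    _ ≤ ∑ s ∈ T, 1 + ∑ i, ∑ j, d i j * (1 / 2) := by
        refine add_le_add (Finset.sum_le_sum fun s hs => by simp [hon s hs s hs])
          (Finset.sum_le_sum fun i _ => Finset.sum_le_sum fun j _ => ?_)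
        · by_cases hij : i = j
          · subst hij; simp [hd]
          · exact mul_le_mul_of_nonneg_left (sum_entry_sq_le_half hB hon hij) (hd0 i j)
    _ ≤ #T + 1 := by
        simp only [← Finset.sum_mul]
        have := sum_max_sub_sq_le hη
        simp only [Finset.sum_const, nsmul_eq_mul, mul_one]
        linarith

lemma sum_frob_commutator_le [DecidableEq ι] [DecidableEq κ] {T : Finset κ}
    {B : κ → Matrix ι ι ℝ} (hB : ∀ s, (B s).IsSymm)
    (hon : ∀ s ∈ T, ∀ t ∈ T, frob (B s) (B t) = if s = t then 1 else 0)
    {A : Matrix ι ι ℝ} (hA : A.IsSymm) (hA1 : frob A A ≤ 1) :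
    ∑ s ∈ T, frob (A * B s - B s * A) (A * B s - B s * A) ≤ #T + 1 := by
  obtain ⟨U, η, hU, hd⟩ := exists_orthogonal_diagonalization hA
  have hη : ∑ i, η i ^ 2 ≤ 1 := by
    have h : frob (diagonal η) (diagonal η) = ∑ i, η i ^ 2 := by
      simp [frob_eq_trace, trace, sq]
    rwa [← h, ← hd, frob_conj hU]
  refine le_of_eq_of_le (Finset.sum_congr rfl fun s _ => ?_)
    (sum_diagonal_commutator_le (B := fun s => Uᵀ * B s * U) (fun s => ?_) (fun s hs t ht => ?_) hη)
  · have h1 : Uᵀ * (A * B s - B s * A) * U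
        = diagonal η * (Uᵀ * B s * U) - (Uᵀ * B s * U) * diagonal η := by
      have h2 : Uᵀ * A * U * (Uᵀ * B s * U) = Uᵀ * A * (U * Uᵀ) * B s * U := by
        simp only [Matrix.mul_assoc]
      have h3 : Uᵀ * B s * U * (Uᵀ * A * U) = Uᵀ * B s * (U * Uᵀ) * A * U := by
        simp only [Matrix.mul_assoc]
      rw [← hd, h2, h3, hU]
      simp only [Matrix.mul_sub, Matrix.sub_mul, Matrix.mul_assoc, Matrix.one_mul]
    rw [← frob_conj hU, h1]
    simp only [frob, Matrix.sub_apply, diagonal_mul, mul_diagonal]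
    exact Finset.sum_congr rfl fun i _ => Finset.sum_congr rfl fun j _ => by ring
  · simp only [Matrix.IsSymm, transpose_mul, transpose_transpose, (hB s).eq, Matrix.mul_assoc]
  · rw [frob_conj hU, hon s hs t ht]

/-- A symmetric kernel whose row sums over every `U ⊆ T` are at most `#U` on `U`
satisfies `∑ λ_r λ_s K_rs ≤ (∑ λ_r)²` for nonnegative weights. -/
lemma sum_mul_mul_le_sq [DecidableEq κ] {K : κ → κ → ℝ} (hK : ∀ r s, K r s = K s r) (T : Finset κ)
    (hrow : ∀ U ⊆ T, ∀ r ∈ U, ∑ s ∈ U, K r s ≤ #U) (w : κ → ℝ) (hw : ∀ r ∈ T, 0 ≤ w r) :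
    ∑ r ∈ T, ∑ s ∈ T, w r * w s * K r s ≤ (∑ r ∈ T, w r) ^ 2 := by
  induction T using Finset.strongInduction generalizing w with
  | H T ih =>
    rcases T.eq_empty_or_nonempty with rfl | hT
    · simp
    obtain ⟨r₀, hr₀, hmin⟩ := T.exists_min_image w hT
    set μ := w r₀
    set v : κ → ℝ := fun r => w r - μ with hv
    have hv0 : v r₀ = 0 := sub_self _
    have hvn : ∀ r ∈ T, 0 ≤ v r := fun r hr => sub_nonneg.2 (hmin r hr)
    have hμ : 0 ≤ μ := hw r₀ hr₀
    have hih := ih (T.erase r₀) (Finset.erase_ssubset hr₀)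
      (fun U hU => hrow U (hU.trans (Finset.erase_subset _ _))) v
      (fun r hr => hvn r (Finset.mem_of_mem_erase hr))
    have e1 : ∀ f : κ → ℝ, f r₀ = 0 → ∑ r ∈ T.erase r₀, f r = ∑ r ∈ T, f r :=
      fun f hf => Finset.sum_erase _ hf
    rw [e1 v hv0, e1 _ (by simp [hv0]),
      Finset.sum_congr rfl fun r _ => e1 (fun s => v r * v s * K r s) (by simp [hv0])] at hih
    have hS : ∑ r ∈ T, w r = ∑ r ∈ T, v r + #T * μ := by
      simp [hv, Finset.sum_sub_distrib]
    have hrowT : ∀ r ∈ T, ∑ s ∈ T, K r s ≤ #T := hrow T subset_rfl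
    have hcross : ∑ r ∈ T, ∑ s ∈ T, v r * K r s ≤ #T * ∑ r ∈ T, v r := by
      rw [Finset.mul_sum]
      refine Finset.sum_le_sum fun r hr => ?_
      rw [← Finset.mul_sum, mul_comm]
      exact mul_le_mul_of_nonneg_right (hrowT r hr) (hvn r hr)
    have hcross' : ∑ r ∈ T, ∑ s ∈ T, v s * K r s = ∑ r ∈ T, ∑ s ∈ T, v r * K r s := by
      rw [Finset.sum_comm]
      exact Finset.sum_congr rfl fun r _ => Finset.sum_congr rfl fun s _ => by rw [hK]
    have hconst : ∑ r ∈ T, ∑ s ∈ T, K r s ≤ #T * #T := by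
      refine (Finset.sum_le_sum hrowT).trans ?_
      simp
    have hexp : ∑ r ∈ T, ∑ s ∈ T, w r * w s * K r s
        = ∑ r ∈ T, ∑ s ∈ T, v r * v s * K r s + μ * ∑ r ∈ T, ∑ s ∈ T, v r * K r s
          + μ * ∑ r ∈ T, ∑ s ∈ T, v s * K r s + μ ^ 2 * ∑ r ∈ T, ∑ s ∈ T, K r s := by
      simp only [Finset.mul_sum, ← Finset.sum_add_distrib]
      refine Finset.sum_congr rfl fun r _ => Finset.sum_congr rfl fun s _ => ?_
      simp only [hv]; ring
    rw [hexp, hcross', hS]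
    nlinarith [mul_le_mul_of_nonneg_left hcross hμ,
      mul_le_mul_of_nonneg_left hconst (sq_nonneg μ)]

/-- The squared Frobenius norm of the commutator. -/
def commSq (M N : Matrix ι ι ℝ) : ℝ := frob (M * N - N * M) (M * N - N * M)

lemma frob_smul_smul (a b : ℝ) (M N : Matrix ι ι ℝ) :
    frob (a • M) (b • N) = a * b * frob M N := by
  simp only [frob, Matrix.smul_apply, smul_eq_mul, Finset.mul_sum]
  exact Finset.sum_congr rfl fun i _ => Finset.sum_congr rfl fun j _ => by ring

lemma commSq_smul_smul (a b : ℝ) (M N : Matrix ι ι ℝ) :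
    commSq (a • M) (b • N) = a ^ 2 * b ^ 2 * commSq M N := by
  have : (a • M) * (b • N) - (b • N) * (a • M) = (a * b) • (M * N - N * M) := by
    simp only [Matrix.smul_mul, Matrix.mul_smul, smul_smul, smul_sub, mul_comm b a]
  rw [commSq, this, frob_smul_smul, commSq]
  ring

lemma commSq_comm (M N : Matrix ι ι ℝ) : commSq M N = commSq N M := by
  simp only [commSq, frob, Matrix.sub_apply]
  exact Finset.sum_congr rfl fun i _ => Finset.sum_congr rfl fun j _ => by ring

lemma frob_self_nonneg (M : Matrix ι ι ℝ) : 0 ≤ frob M M :=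
  Finset.sum_nonneg fun _ _ => Finset.sum_nonneg fun _ _ => mul_self_nonneg _

lemma eq_zero_of_frob_self_eq_zero {M : Matrix ι ι ℝ} (h : frob M M = 0) : M = 0 := by
  ext i j
  have h1 := (Finset.sum_eq_zero_iff_of_nonneg fun i _ =>
    Finset.sum_nonneg fun j _ => mul_self_nonneg (M i j)).1 h i (mem_univ _)
  have h2 := (Finset.sum_eq_zero_iff_of_nonneg fun j _ => mul_self_nonneg (M i j)).1 h1 j
    (mem_univ _)
  simpa using h2

/-- The DDVV inequality for pairwise orthogonal symmetric matrices. -/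
lemma sum_commSq_le_of_orthogonal [DecidableEq ι] [Fintype κ] [DecidableEq κ]
    {C : κ → Matrix ι ι ℝ} (hC : ∀ r, (C r).IsSymm)
    (horth : ∀ r s, r ≠ s → frob (C r) (C s) = 0) :
    ∑ r, ∑ s, commSq (C r) (C s) ≤ (∑ r, frob (C r) (C r)) ^ 2 := by
  set a : κ → ℝ := fun r => √(frob (C r) (C r)) with ha
  have ha2 : ∀ r, a r ^ 2 = frob (C r) (C r) := fun r => Real.sq_sqrt (frob_self_nonneg _)
  set B : κ → Matrix ι ι ℝ := fun r => (a r)⁻¹ • C r with hBdef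
  have hB : ∀ r, (B r).IsSymm := fun r => (hC r).smul _
  have hCB : ∀ r, C r = a r • B r := by
    intro r
    by_cases h : a r = 0
    · rw [h, zero_smul]
      exact eq_zero_of_frob_self_eq_zero (by rw [← ha2, h]; norm_num)
    · rw [hBdef, smul_smul, mul_inv_cancel₀ h, one_smul]
  have hle : ∀ r, frob (B r) (B r) ≤ 1 := by
    intro r
    rw [hBdef, frob_smul_smul, ← ha2]
    by_cases h : a r = 0
    · simp [h]
    · field_simp; rfl
  set T : Finset κ := univ.filter fun r => a r ≠ 0 with hT
  have hon : ∀ r ∈ T, ∀ s ∈ T, frob (B r) (B s) = if r = s then 1 else 0 := by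
    intro r hr s _
    rw [hBdef, frob_smul_smul]
    split_ifs with h
    · subst h
      have : a r ≠ 0 := (Finset.mem_filter.1 hr).2
      rw [← ha2]
      field_simp
    · rw [horth r s h, mul_zero]
  have key := sum_mul_mul_le_sq (K := fun r s => commSq (B r) (B s)) (fun r s => commSq_comm _ _) T
    (fun U hU r hr => by
      have h1 := sum_frob_commutator_le (T := U.erase r) hB
        (fun s hs t ht => hon s (hU (Finset.mem_of_mem_erase hs)) t
          (hU (Finset.mem_of_mem_erase ht))) (hB r) (hle r)
      have h2 : commSq (B r) (B r) = 0 := by simp [commSq, frob]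
      rw [← Finset.add_sum_erase _ _ hr, h2, zero_add]
      refine h1.trans (le_of_eq ?_)
      have := Finset.card_erase_add_one hr
      exact_mod_cast this)
    (fun r => a r ^ 2) (fun r _ => sq_nonneg _)
  have ext : ∀ f : κ → ℝ, (∀ r, a r = 0 → f r = 0) → ∑ r ∈ T, f r = ∑ r, f r := by
    intro f hf
    refine Finset.sum_subset (Finset.subset_univ _) fun r _ hr => hf r ?_
    simpa [hT] using hr
  rw [ext _ (fun r h => by simp [h]), ext _ (fun r h => by simp [h]),
    Finset.sum_congr rfl fun r _ => ext _ (fun s h => by simp [h])] at key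
  refine le_of_eq_of_le ?_ (key.trans_eq ?_)
  · refine Finset.sum_congr rfl fun r _ => Finset.sum_congr rfl fun s _ => ?_
    rw [hCB r, hCB s, commSq_smul_smul]
  · simp only [ha2]

lemma frob_orthogonal_mul [Fintype κ] [DecidableEq κ] {Q : Matrix κ κ ℝ} (hQ : Q * Qᵀ = 1)
    (G : Matrix κ κ ℝ) :
    ∑ r, ∑ s, (Qᵀ * G * Q) r s ^ 2 = ∑ r, ∑ s, G r s ^ 2 := by
  simpa only [frob, ← sq] using frob_conj hQ G G

lemma sum_commSq_eq [Fintype κ] (f : κ → Matrix ι ι ℝ) : ∑ r, ∑ s, commSq (f r) (f s)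
    = ∑ i, ∑ j, ∑ r, ∑ s, (f r * f s - f s * f r) i j ^ 2 := by
  simp only [commSq, frob, ← sq]
  rw [Finset.sum_congr rfl fun r _ => Finset.sum_comm, Finset.sum_comm]
  refine Finset.sum_congr rfl fun i _ => ?_
  rw [Finset.sum_congr rfl fun r _ => Finset.sum_comm, Finset.sum_comm]

/-- The DDVV inequality: `∑ ‖[h_r, h_s]‖² ≤ (∑ ‖h_r‖²)²` for real symmetric matrices. -/
theorem sum_commSq_le [DecidableEq ι] [Fintype κ] [DecidableEq κ]
    {h : κ → Matrix ι ι ℝ} (hh : ∀ r, (h r).IsSymm) :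
    ∑ r, ∑ s, commSq (h r) (h s) ≤ (∑ r, frob (h r) (h r)) ^ 2 := by
  set G : Matrix κ κ ℝ := Matrix.of fun r s => frob (h r) (h s) with hG
  have hGs : G.IsSymm := by
    ext r s
    simp [hG, frob, mul_comm]
  obtain ⟨Q, η, hQ, hd⟩ := exists_orthogonal_diagonalization hGs
  set C : κ → Matrix ι ι ℝ := fun r => ∑ s, Q s r • h s with hCdef
  have hC : ∀ r, (C r).IsSymm := fun r => by
    simp only [Matrix.IsSymm, hCdef, transpose_sum, transpose_smul, (hh _).eq]
  have hfrob : ∀ r s, frob (C r) (C s) = diagonal η r s := by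
    intro r s
    rw [← hd]
    simp only [hCdef, frob_sum_smul, mul_apply, transpose_apply, hG, Matrix.of_apply,
      Finset.sum_mul]
    rw [Finset.sum_comm]
    exact Finset.sum_congr rfl fun _ _ => Finset.sum_congr rfl fun _ _ => by ring
  have key := sum_commSq_le_of_orthogonal hC fun r s hrs => by
    rw [hfrob, diagonal_apply_ne _ hrs]
  have hnorm : ∑ r, frob (C r) (C r) = ∑ r, frob (h r) (h r) := by
    have h1 : ∑ r, frob (C r) (C r) = trace (Qᵀ * G * Q) := by
      rw [hd]; simp only [hfrob, trace, diag_apply]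
    rw [h1, trace_mul_comm, ← Matrix.mul_assoc, hQ, Matrix.one_mul]
    rfl
  have hcomm : ∑ r, ∑ s, commSq (C r) (C s) = ∑ r, ∑ s, commSq (h r) (h s) := by
    rw [sum_commSq_eq, sum_commSq_eq]
    refine Finset.sum_congr rfl fun i _ => Finset.sum_congr rfl fun j _ => ?_
    refine Eq.trans ?_
      (frob_orthogonal_mul hQ (Matrix.of fun r s => (h r * h s - h s * h r) i j))
    refine Finset.sum_congr rfl fun r _ => Finset.sum_congr rfl fun s _ => ?_
    congr 1
    have h1 : C r * C s - C s * C r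
        = ∑ t, ∑ u, (Q u r * Q t s) • (h u * h t - h t * h u) := by
      simp only [hCdef, Finset.sum_mul_sum, Matrix.smul_mul, Matrix.mul_smul,
        smul_smul, smul_sub, Finset.sum_sub_distrib]
      rw [Finset.sum_comm]
      congr 1
      exact Finset.sum_congr rfl fun _ _ => Finset.sum_congr rfl fun _ _ => by rw [mul_comm]
    rw [h1]
    simp only [Matrix.sum_apply, Matrix.smul_apply, smul_eq_mul, mul_apply (M := Qᵀ * _),
      mul_apply (M := Qᵀ), transpose_apply, Matrix.of_apply, Finset.sum_mul]
    exact Finset.sum_congr rfl fun _ _ => Finset.sum_congr rfl fun _ _ => by ring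
  rwa [hnorm, hcomm] at key

end DDVV

lemma sum_ite_lt {n : ℕ} {f : Fin n → Fin n → ℝ} (hf : ∀ i j, f i j = f j i)
    (hf0 : ∀ i, f i i = 0) :
    ∑ i, ∑ j, (if i < j then f i j else 0) = 1 / 2 * ∑ i, ∑ j, f i j := by
  have h1 : ∑ i, ∑ j, (if i < j then f i j else 0) = ∑ i, ∑ j, (if j < i then f i j else 0) := by
    rw [Finset.sum_comm]
    exact Finset.sum_congr rfl fun i _ => Finset.sum_congr rfl fun j _ => by rw [hf]
  have h2 : ∑ i, ∑ j, f i j = ∑ i, ∑ j, (if i < j then f i j else 0)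
      + ∑ i, ∑ j, (if j < i then f i j else 0) := by
    simp only [← Finset.sum_add_distrib]
    refine Finset.sum_congr rfl fun i _ => Finset.sum_congr rfl fun j _ => ?_
    rcases lt_trichotomy i j with h | rfl | h
    · simp [h, h.not_gt]
    · simp [hf0]
    · simp [h, h.not_gt]
  rw [h2, ← h1]
  ring

/-- The sum of squares of normal curvature components under the Ricci equation. -/
lemma sum_normal_curvature_sq {n p : ℕ} {h : Fin p → Matrix (Fin n) (Fin n) ℝ}
    (hsymm : ∀ r, (h r).IsSymm) {Rp : Fin n → Fin n → Fin p → Fin p → ℝ}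
    (ricci : ∀ i j r s, Rp i j r s = (h r * h s - h s * h r) j i) :
    ∑ i, ∑ j, ∑ r, ∑ s, (if i < j ∧ r < s then Rp i j r s ^ 2 else 0)
      = 1 / 4 * ∑ r, ∑ s, commSq (h r) (h s) := by
  have hnormal : ∀ i j r s, Rp i j r s = -Rp i j s r := fun i j r s => by
    rw [ricci, ricci, ← neg_sub (h s * h r), Matrix.neg_apply]
  have htangent : ∀ i j r s, Rp i j r s = -Rp j i r s := fun i j r s => by
    have : (h r * h s - h s * h r)ᵀ = -(h r * h s - h s * h r) := by
      rw [transpose_sub, transpose_mul, transpose_mul, (hsymm r).eq, (hsymm s).eq, neg_sub]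
    rw [ricci, ricci, ← Matrix.neg_apply, ← this, transpose_apply]
  have h1 : ∀ i j, ∑ r, ∑ s, (if i < j ∧ r < s then Rp i j r s ^ 2 else 0)
      = if i < j then 1 / 2 * ∑ r, ∑ s, Rp i j r s ^ 2 else 0 := by
    intro i j
    split_ifs with hij
    · simp only [hij, true_and]
      refine sum_ite_lt (fun r s => by rw [hnormal, neg_sq]) fun r => ?_
      have := hnormal i j r r
      rw [pow_eq_zero_iff two_ne_zero]
      linarith
    · simp [hij]
  simp only [h1]
  rw [sum_ite_lt (fun i j => by simp only [htangent i j, neg_sq]) fun i => ?_]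
  · have h2 : ∑ r, ∑ s, commSq (h r) (h s) = ∑ i, ∑ j, ∑ r, ∑ s, Rp i j r s ^ 2 := by
      rw [sum_commSq_eq, Finset.sum_comm]
      simp only [ricci]
    rw [h2]
    simp only [← Finset.mul_sum]
    ring
  · have : ∀ r s, Rp i i r s = 0 := fun r s => by linarith [htangent i i r s]
    simp [this]

/-- The Gauss equation traced over a minimal submanifold of a conformally flat space. -/
lemma two_mul_scalarCurv_eq {n m : ℕ} (hnm : n ≤ m)
    (Rt : Fin m → Fin m → Fin m → Fin m → ℝ)
    (R : Fin n → Fin n → Fin n → Fin n → ℝ)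
    (h : Fin (m - n) → Matrix (Fin n) (Fin n) ℝ)
    (hsymm : ∀ r, (h r).IsSymm)
    (hmin : ∀ r : Fin (m - n), ∑ i : Fin n, h r i i = 0)
    (weyl : ∀ x y z w : Fin m, Rt x y z w =
      (1 / ((m : ℝ) - 2)) *
        (ambRicci Rt y z * kdelta x w - ambRicci Rt x z * kdelta y w
          + ambRicci Rt x w * kdelta y z - ambRicci Rt y w * kdelta x z)
      - (2 * ambScalar Rt / (((m : ℝ) - 1) * ((m : ℝ) - 2))) *
          (kdelta y z * kdelta x w - kdelta x z * kdelta y w))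
    (gauss : ∀ i j k l : Fin n, R i j k l =
      Rt (Fin.castLE hnm i) (Fin.castLE hnm j) (Fin.castLE hnm k) (Fin.castLE hnm l)
      + ∑ r : Fin (m - n), (h r i l * h r j k - h r i k * h r j l)) :
    2 * scalarCurv R = 1 / ((m : ℝ) - 2) * (2 * ((n : ℝ) - 1) *
        ∑ j : Fin n, ambRicci Rt (Fin.castLE hnm j) (Fin.castLE hnm j))
      - 2 * ambScalar Rt / (((m : ℝ) - 1) * ((m : ℝ) - 2)) * (n * ((n : ℝ) - 1))
      - ∑ r, frob (h r) (h r) := by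
  set c := 1 / ((m : ℝ) - 2)
  set d := 2 * ambScalar Rt / (((m : ℝ) - 1) * ((m : ℝ) - 2))
  set ric : Fin n → ℝ := fun j => ambRicci Rt (Fin.castLE hnm j) (Fin.castLE hnm j) with hric
  have hf : ∀ i j, R i j j i = c * (ric j + ric i - if i = j then 2 * ric i else 0)
      - d * (1 - if i = j then 1 else 0) + ∑ r, (h r i i * h r j j - h r i j * h r i j) := by
    intro i j
    rw [gauss, weyl]
    congr 1
    · by_cases hij : i = j
      · subst hij; simp only [kdelta, hric, if_true]; ring
      · have : Fin.castLE hnm i ≠ Fin.castLE hnm j := fun e => hij (Fin.castLE_injective hnm e)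
        simp [kdelta, hric, hij, this, this.symm]
    · exact Finset.sum_congr rfl fun r _ => by rw [(hsymm r).apply i j]
  have hsum : ∑ i, ∑ j, ∑ r, (h r i i * h r j j - h r i j * h r i j)
      = - ∑ r, frob (h r) (h r) := by
    rw [Finset.sum_congr rfl fun i _ => Finset.sum_comm, Finset.sum_comm, ← Finset.sum_neg_distrib]
    refine Finset.sum_congr rfl fun r _ => ?_
    simp only [Finset.sum_sub_distrib, ← Finset.mul_sum, hmin, frob]
    simp
  rw [scalarCurv, sum_ite_lt (f := fun i j => R i j j i)]
  · simp only [hf]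
    rw [Finset.sum_congr rfl fun i _ => Finset.sum_add_distrib, Finset.sum_add_distrib, hsum]
    simp only [Finset.sum_sub_distrib, Finset.sum_add_distrib, ← Finset.mul_sum, mul_sub, mul_add,
      Finset.sum_ite_eq, Finset.mem_univ, if_true, Finset.sum_const, Finset.card_univ,
      Fintype.card_fin, nsmul_eq_mul]
    ring
  · intro i j
    simp only [hf]
    congr 1
    · by_cases hij : i = j
      · subst hij; rfl
      · rw [if_neg hij, if_neg hij, if_neg (Ne.symm hij), if_neg (Ne.symm hij)]; ring
    · exact Finset.sum_congr rfl fun r _ => by rw [(hsymm r).apply i j]; ring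
  · intro i
    simp only [hf, if_true, sub_self, Finset.sum_const_zero]; ring

/-- **Generalized Wintgen inequality for `ρ^⊥`, minimal case.**
If moreover the submanifold is minimal (hypothesis `hmin`), then
`ρ + ρ^⊥ ≤ (2/(n(m-2))) ∑_j Ric~(e_j,e_j) - 2τ~/((m-1)(m-2))`. -/
theorem wintgen_rhoPerp_conformally_flat_minimal {n m : ℕ}
    (hn : 3 ≤ n) (hm : 4 ≤ m) (hnm : n ≤ m)
    (Rt : Fin m → Fin m → Fin m → Fin m → ℝ)
    (R : Fin n → Fin n → Fin n → Fin n → ℝ)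
    (h : Fin (m - n) → Matrix (Fin n) (Fin n) ℝ)
    (hsymm : ∀ r, (h r).IsSymm)
    (hmin : ∀ r : Fin (m - n), ∑ i : Fin n, h r i i = 0)
    (Rperp : Fin n → Fin n → Fin (m - n) → Fin (m - n) → ℝ)
    (ricci : ∀ (i j : Fin n) (r s : Fin (m - n)),
      Rperp i j r s = (h r * h s - h s * h r) j i)
    (weyl : ∀ x y z w : Fin m, Rt x y z w =
      (1 / ((m : ℝ) - 2)) *
        (ambRicci Rt y z * kdelta x w - ambRicci Rt x z * kdelta y w
          + ambRicci Rt x w * kdelta y z - ambRicci Rt y w * kdelta x z)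
      - (2 * ambScalar Rt / (((m : ℝ) - 1) * ((m : ℝ) - 2))) *
          (kdelta y z * kdelta x w - kdelta x z * kdelta y w))
    (gauss : ∀ i j k l : Fin n, R i j k l =
      Rt (Fin.castLE hnm i) (Fin.castLE hnm j) (Fin.castLE hnm k) (Fin.castLE hnm l)
      + ∑ r : Fin (m - n), (h r i l * h r j k - h r i k * h r j l)) :
    normScalarCurv R + rhoPerp Rperp ≤ 2 / ((n : ℝ) * ((m : ℝ) - 2)) *
          ∑ j : Fin n, ambRicci Rt (Fin.castLE hnm j) (Fin.castLE hnm j)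
      - 2 * ambScalar Rt / (((m : ℝ) - 1) * ((m : ℝ) - 2)) := by
  have hn' : (3 : ℝ) ≤ n := by exact_mod_cast hn
  have hm' : (4 : ℝ) ≤ m := by exact_mod_cast hm
  set S := ∑ r, frob (h r) (h r) with hS
  have hS0 : 0 ≤ S := Finset.sum_nonneg fun r _ => frob_self_nonneg _
  have hnn : (0 : ℝ) < n * ((n : ℝ) - 1) := by nlinarith
  have hsqrt : Real.sqrt (∑ i, ∑ j, ∑ r, ∑ s,
      if i < j ∧ r < s then Rperp i j r s ^ 2 else 0) ≤ S / 2 := by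
    rw [sum_normal_curvature_sq hsymm ricci]
    refine Real.sqrt_le_iff.2 ⟨by linarith, ?_⟩
    have := sum_commSq_le hsymm
    rw [← hS] at this
    nlinarith
  have hperp : rhoPerp Rperp ≤ 2 / ((n : ℝ) * ((n : ℝ) - 1)) * (S / 2) :=
    mul_le_mul_of_nonneg_left hsqrt (by positivity)
  have hscal := two_mul_scalarCurv_eq hnm Rt R h hsymm hmin weyl gauss
  rw [← hS] at hscal
  have hm1 : (m : ℝ) - 1 ≠ 0 := by linarith
  have hm2 : (m : ℝ) - 2 ≠ 0 := by linarith
  have hn0 : (n : ℝ) ≠ 0 := by linarith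
  have hn1 : (n : ℝ) - 1 ≠ 0 := by linarith
  refine (add_le_add_right hperp _).trans_eq ?_
  rw [normScalarCurv, hscal]
  field_simp
  ring
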